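/- For n ∈ ℤ and k, t ∈ ℕ define R^n_{k,t} := Σ_{j=0}^{k} (−1)^{k−j} q^{(k−j)(k−j−1)/2} binom_q(k,j) ⟨q^{n−k+j}; t+j⟩_q ⟨q^{k+t}; k−j⟩_q ∈ ℤ[q,q^{−1}]. Then for all n ∈ ℤ and k, t ∈ ℕ: R^n_{k+1,t} = −q^k (q^{k+t+1} + 1) R^{n−1}_{k,t} + R^n_{k,t+1}. -/

import Mathlib

open Finset

noncomputable section

/-- The base field `ℚ(q)` of rational functions over `ℚ`. -/
abbrev K : Type := RatFunc ℚ

/-- The indeterminate `q`. -/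
def q : K := RatFunc.X

/-- The `x`-number `(n)_x = (x^n - 1)/(x - 1)`. -/
def qn (x : K) (n : ℕ) : K := (x ^ n - 1) / (x - 1)

/-- The `x`-factorial `(n)_x!`. -/
def qnFact (x : K) (n : ℕ) : K := ∏ r ∈ Finset.Icc 1 n, qn x r

/-- The `x`-binomial coefficient `binom_x(n,s)`, zero when `s > n`. -/
def qBinom (x : K) (n s : ℕ) : K :=
  if s ≤ n then qnFact x n / (qnFact x s * qnFact x (n - s)) else 0

/-- The balanced `q`-integer `[n]_q = (q^n - q^{-n})/(q - q^{-1})`. -/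
def qint (n : ℕ) : K := (q ^ n - q⁻¹ ^ n) / (q - q⁻¹)

/-- The balanced `q`-factorial `[n]_q!`. -/
def qintFact (n : ℕ) : K := ∏ r ∈ Finset.Icc 1 n, qint r

variable {A : Type*} [Ring A] [Algebra K A]

/-- The `q`-divided power `X^{(n)} = X^n / [n]_q!`. -/
def dp (X : A) (n : ℕ) : A := (qintFact n)⁻¹ • X ^ n

/-- The `q`-binomial coefficient `C_q(X; c, n) = ∏_{s=1}^n (q^{c+1-s} X - 1)/(q^s - 1)`. -/
def Cq (X : A) (c : ℤ) : ℕ → A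
  | 0 => 1
  | n + 1 => (q ^ ((n : ℤ) + 1) - 1)⁻¹ • (Cq X c n * (q ^ (c - (n : ℤ)) • X - 1))

/-- The bracket `{X; c | n, r} = Σ_{s=0}^r q^{s(s+1)/2} binom_q(r,s) C_q(X; c+s, n-r)`. -/
def Sq (X : A) (c : ℤ) (n r : ℕ) : A :=
  ∑ s ∈ Finset.range (r + 1),
    (q ^ (s * (s + 1) / 2) * qBinom q r s) • Cq X (c + (s : ℤ)) (n - r)

end

noncomputable section

/-- `⟨x; m⟩_q = ∏_{s=1}^{m} (x q^{1-s} + 1)`. -/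
def qAngle (x : K) (m : ℕ) : K := ∏ s ∈ Finset.Icc 1 m, (x * q ^ (1 - (s : ℤ)) + 1)

/-- The quantity `R^n_{k,t}` of the paper. -/
def R (n : ℤ) (k t : ℕ) : K :=
  ∑ j ∈ Finset.range (k + 1),
    (-1 : K) ^ (k - j) * q ^ ((k - j) * (k - j - 1) / 2) * qBinom q k j *
      qAngle (q ^ (n - k + j)) (t + j) * qAngle (q ^ ((k : ℤ) + t)) (k - j)

lemma q_ne_zero : q ≠ 0 := RatFunc.X_ne_zero

lemma q_pow_sub_one_ne_zero (n : ℕ) : q ^ (n + 1) - 1 ≠ 0 := by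
  intro h
  have h1 : algebraMap (Polynomial ℚ) (RatFunc ℚ) (Polynomial.X ^ (n + 1)) =
      algebraMap (Polynomial ℚ) (RatFunc ℚ) 1 := by
    rw [map_pow, RatFunc.algebraMap_X, map_one]
    exact sub_eq_zero.mp h
  have h2 := congrArg Polynomial.natDegree (RatFunc.algebraMap_injective ℚ h1)
  simp at h2

lemma q_sub_one_ne_zero : q - 1 ≠ 0 := by
  simpa using q_pow_sub_one_ne_zero 0

lemma qn_succ_ne_zero (n : ℕ) : qn q (n + 1) ≠ 0 :=
  div_ne_zero (q_pow_sub_one_ne_zero n) q_sub_one_ne_zero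

lemma qnFact_succ (x : K) (n : ℕ) : qnFact x (n + 1) = qnFact x n * qn x (n + 1) :=
  Finset.prod_Icc_succ_top (Nat.le_add_left 1 n) _

lemma qnFact_zero (x : K) : qnFact x 0 = 1 := by simp [qnFact]

lemma qnFact_ne_zero (n : ℕ) : qnFact q n ≠ 0 := by
  induction n with
  | zero => simp [qnFact_zero]
  | succ n ih => rw [qnFact_succ]; exact mul_ne_zero ih (qn_succ_ne_zero n)

lemma qBinom_self (n : ℕ) : qBinom q n n = 1 := by
  simp [qBinom, qnFact_zero, qnFact_ne_zero]

lemma qBinom_zero_right (n : ℕ) : qBinom q n 0 = 1 := by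
  simp [qBinom, qnFact_zero, qnFact_ne_zero]

lemma qBinom_eq_zero_of_lt (x : K) {n s : ℕ} (h : n < s) : qBinom x n s = 0 :=
  if_neg (Nat.not_le.mpr h)

lemma qn_add (x : K) (a b : ℕ) : qn x (a + b) = qn x a + x ^ a * qn x b := by
  unfold qn
  ring

/-- The `q`-Pascal rule. -/
lemma qBinom_succ_succ (n s : ℕ) :
    qBinom q (n + 1) (s + 1) = q ^ (s + 1) * qBinom q n (s + 1) + qBinom q n s := by
  rcases lt_trichotomy n s with h | rfl | h
  · rw [qBinom_eq_zero_of_lt q h, qBinom_eq_zero_of_lt q (by omega : n < s + 1),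
      qBinom_eq_zero_of_lt q (by omega : n + 1 < s + 1)]
    ring
  · rw [qBinom_self, qBinom_self, qBinom_eq_zero_of_lt q (Nat.lt_succ_self n)]
    ring
  · obtain ⟨m, rfl⟩ : ∃ m, n = s + 1 + m := ⟨n - (s + 1), by omega⟩
    have e : qn q (s + 1 + m + 1) = qn q (s + 1) + q ^ (s + 1) * qn q (m + 1) :=
      qn_add q (s + 1) (m + 1)
    rw [qBinom, qBinom, qBinom, if_pos (by omega), if_pos (by omega), if_pos (by omega),
      show s + 1 + m + 1 - (s + 1) = m + 1 by omega, show s + 1 + m - (s + 1) = m by omega,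
      show s + 1 + m - s = m + 1 by omega, qnFact_succ q (s + 1 + m), qnFact_succ q s,
      qnFact_succ q m, e]
    have h1 := qnFact_ne_zero s
    have h2 := qnFact_ne_zero m
    have h3 := qn_succ_ne_zero s
    have h4 := qn_succ_ne_zero m
    field_simp
    ring

lemma qAngle_mul_q_succ (x : K) (m : ℕ) :
    qAngle (x * q) (m + 1) = (x * q + 1) * qAngle x m := by
  induction m with
  | zero => simp [qAngle]
  | succ m ih =>
    have key (y : K) (m : ℕ) : qAngle y (m + 1) = qAngle y m * (y * q ^ (-(m : ℤ)) + 1) := by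
      unfold qAngle
      rw [Finset.prod_Icc_succ_top (Nat.le_add_left 1 m)]
      congr 4
      push_cast
      ring
    have e : x * q * q ^ (-((m + 1 : ℕ) : ℤ)) = x * q ^ (-(m : ℤ)) := by
      rw [mul_assoc, ← zpow_one_add₀ q_ne_zero]
      congr 2
      push_cast
      ring
    rw [key (x * q) (m + 1), ih, key x m, e]
    ring

lemma half_mul_succ (m : ℕ) : (m + 1) * (m + 1 - 1) / 2 = m * (m - 1) / 2 + m := by
  rw [← Nat.choose_two_right, ← Nat.choose_two_right, Nat.choose_succ_succ' m 1,
    Nat.choose_one_right, add_comm]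

theorem statement12 (n : ℤ) (k t : ℕ) :
    R n (k + 1) t = -q ^ k * (q ^ (k + t + 1) + 1) * R (n - 1) k t + R n k (t + 1) := by
  set F : ℕ → K := fun j =>
    (-1 : K) ^ (k + 1 - j) * q ^ ((k + 1 - j) * (k + 1 - j - 1) / 2) *
      qAngle (q ^ (n - 1 - k + j)) (t + j) * qAngle (q ^ ((k : ℤ) + 1 + t)) (k + 1 - j) with hF
  have h0 : R n (k + 1) t = ∑ j ∈ Finset.range (k + 2), F j * qBinom q (k + 1) j := by
    refine Finset.sum_congr rfl fun j _ => ?_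
    simp only [hF]
    rw [show n - ((k + 1 : ℕ) : ℤ) + j = n - 1 - k + j by push_cast; ring,
      show ((k + 1 : ℕ) : ℤ) = (k : ℤ) + 1 by push_cast; rfl]
    ring
  have h1 : -q ^ k * (q ^ (k + t + 1) + 1) * R (n - 1) k t =
      ∑ j ∈ Finset.range (k + 1), F j * (q ^ j * qBinom q k j) := by
    rw [R, Finset.mul_sum]
    refine Finset.sum_congr rfl fun j hj => ?_
    obtain ⟨m, hm⟩ : ∃ m, k = j + m :=
      ⟨k - j, by have := Finset.mem_range.mp hj; omega⟩
    have e1 : q ^ ((k : ℤ) + 1 + t) = q ^ ((k : ℤ) + t) * q := by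
      rw [← zpow_add_one₀ q_ne_zero]
      congr 1
      ring
    have e2 : q ^ (k + t + 1) = q ^ ((k : ℤ) + t) * q := by
      rw [pow_succ]
      norm_cast
    have e3 : q ^ k = q ^ j * q ^ m := by rw [hm, pow_add]
    simp only [hF]
    rw [e1, e2, e3, show k + 1 - j = m + 1 by omega, show k - j = m by omega,
      qAngle_mul_q_succ, half_mul_succ, pow_succ (-1 : K), pow_add q]
    ring
  have h2 : R n k (t + 1) = ∑ j ∈ Finset.range (k + 1), F (j + 1) * qBinom q k j := by
    refine Finset.sum_congr rfl fun j _ => ?_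
    simp only [hF]
    rw [show n - 1 - k + ((j + 1 : ℕ) : ℤ) = n - k + j by push_cast; ring,
      show (k : ℤ) + ((t + 1 : ℕ) : ℤ) = k + 1 + t by push_cast; ring,
      Nat.add_sub_add_right, show t + 1 + j = t + (j + 1) by ring]
    ring
  have h3 : ∑ j ∈ Finset.range (k + 1), F j * (q ^ j * qBinom q k j) =
      ∑ j ∈ Finset.range (k + 2), F j * (q ^ j * qBinom q k j) := by
    rw [Finset.sum_range_succ _ (k + 1), qBinom_eq_zero_of_lt q (Nat.lt_succ_self k)]
    ring
  rw [h0, h1, h2, h3, Finset.sum_range_succ' _ (k + 1), Finset.sum_range_succ' _ (k + 1),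
    add_right_comm, ← Finset.sum_add_distrib]
  congr 1
  · refine Finset.sum_congr rfl fun j _ => ?_
    rw [qBinom_succ_succ]
    ring
  · simp [qBinom_zero_right]

end
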